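/- arXiv:1012.2342 — 2 statements merged into one kernel-verified Lean document; each statement's English description precedes it below -/
import Mathlib

section
/- Let ε > 0, M ≥ ε, and A > 0. Let (B_n) be a sequence of positive reals with B_n → +∞, and let (φ_n) be a sequence of real-valued functions on [0,1) such that each φ_n is monotone increasing on [0,1) and |φ_n(t) - t| ≤ A·t² for all t ∈ [0,1) and all n. Then there exist a constant C > 0 and an index N such that for all n ≥ N and all complex x with ε ≤ Re x ≤ M, one has |∫_0^1 exp(-B_n·φ_n(t))·t^{x-1} dt - B_n^{-x}·Γ(x)| ≤ C·B_n^{-Re x - 1}, where t^{x-1} := exp((x-1)·log t) for t ∈ (0,1) and B_n^{-x} := exp(-x·log B_n). -/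
open MeasureTheory Set

theorem abs_exp_neg_sub_exp_neg_le {a b m : ℝ} (ha : m ≤ a) (hb : m ≤ b) :
    |Real.exp (-a) - Real.exp (-b)| ≤ |a - b| * Real.exp (-m) := by
  wlog h : a ≤ b generalizing a b
  · rw [abs_sub_comm, abs_sub_comm a]
    exact this hb ha (le_of_not_ge h)
  have hexp : Real.exp (-b) = Real.exp (-a) * Real.exp (a - b) := by
    rw [← Real.exp_add]; ring_nf
  rw [abs_of_nonneg (sub_nonneg.2 (Real.exp_le_exp.2 (neg_le_neg h))), abs_sub_comm,
    abs_of_nonneg (sub_nonneg.2 h)]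
  calc Real.exp (-a) - Real.exp (-b) = Real.exp (-a) * (1 - Real.exp (a - b)) := by
        rw [hexp]; ring
    _ ≤ Real.exp (-a) * (b - a) := by
        refine mul_le_mul_of_nonneg_left ?_ (Real.exp_pos _).le
        linarith [Real.add_one_le_exp (a - b)]
    _ ≤ Real.exp (-m) * (b - a) := by
        gcongr
    _ = (b - a) * Real.exp (-m) := mul_comm _ _

/-- An increasing function on `[0,1)` that is quadratically close to the identity dominates a
linear function whose slope depends only on the constant `A`. -/
theorem MonotoneOn.mul_le_of_abs_sub_le {A : ℝ} (hA : 0 ≤ A) {f : ℝ → ℝ}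
    (hf : MonotoneOn f (Ico 0 1)) (hfA : ∀ t ∈ Ico (0 : ℝ) 1, |f t - t| ≤ A * t ^ 2)
    {t : ℝ} (ht : t ∈ Ico (0 : ℝ) 1) : 1 / (4 * (A + 1)) * t ≤ f t := by
  obtain ⟨d, hd⟩ : ∃ d, d = 1 / (2 * (A + 1)) := ⟨_, rfl⟩
  have hd0 : 0 < d := by rw [hd]; positivity
  have hdA : d * (A + 1) = 1 / 2 := by rw [hd]; field_simp
  have hd1 : d ≤ 1 / 2 := by nlinarith
  have hc : 1 / (4 * (A + 1)) = d / 2 := by rw [hd]; field_simp; norm_num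
  have key : ∀ s, 0 ≤ s → s ≤ d → s / 2 ≤ f s := by
    intro s hs0 hsd
    have h1 := (abs_le.1 (hfA s ⟨hs0, by linarith⟩)).1
    have h2 : A * s ≤ 1 / 2 := by nlinarith
    nlinarith
  rw [hc]
  rcases le_total t d with h | h
  · nlinarith [key t ht.1 h, ht.1]
  · nlinarith [key d hd0.le le_rfl, hf ⟨hd0.le, by linarith⟩ ht h, ht.2]

theorem Complex.norm_exp_mul_log {t : ℝ} (ht : 0 < t) (z : ℂ) :
    ‖Complex.exp (z * (Real.log t : ℂ))‖ = t ^ z.re := by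
  rw [Complex.norm_exp, Complex.re_mul_ofReal, Real.rpow_def_of_pos ht, mul_comm]

theorem integrableOn_exp_neg_mul_mul_rpow {b s : ℝ} (hb : 0 < b) (hs : -1 < s) :
    IntegrableOn (fun t : ℝ ↦ Real.exp (-(b * t)) * t ^ s) (Ioi 0) := by
  simpa [mul_comm] using integrableOn_rpow_mul_exp_neg_mul_rpow hs one_pos hb

/-- Watson's lemma for a phase `f` on `(0,1)` with `|f t - t| ≤ A t²` and `c t ≤ f t`, with an
explicit error bound of order `b^{-Re x - 1}`. -/
theorem norm_integral_exp_mul_cpow_sub_Gamma_le {A b c : ℝ} (hA : 0 ≤ A) (hb : 1 ≤ b)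
    (hc : 0 < c) (hc1 : c ≤ 1) {f : ℝ → ℝ} (hfm : AEMeasurable f (volume.restrict (Ioo 0 1)))
    (hfA : ∀ t ∈ Ioo (0 : ℝ) 1, |f t - t| ≤ A * t ^ 2) (hfc : ∀ t ∈ Ioo (0 : ℝ) 1, c * t ≤ f t)
    {x : ℂ} (hx : 0 < x.re) :
    ‖(∫ t in (0:ℝ)..1,
          Complex.exp (-(b : ℂ) * (f t : ℂ)) * Complex.exp ((x - 1) * (Real.log t : ℂ)))
        - Complex.exp (-x * (Real.log b : ℂ)) * Complex.Gamma x‖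
      ≤ (A + 1) * b * ((1 / (c * b)) ^ (x.re + 2) * Real.Gamma (x.re + 2)) := by
  have hb0 : 0 < b := one_pos.trans_le hb
  have hcb : 0 < c * b := mul_pos hc hb0
  have hx1 : -1 < x.re - 1 := by linarith
  set p : ℝ → ℂ := fun t ↦ Complex.exp ((x - 1) * (Real.log t : ℂ)) with hp
  have hpm : Measurable p := by fun_prop
  have hpn : ∀ t, 0 < t → ‖p t‖ = t ^ (x.re - 1) := fun t ht ↦ by
    simp only [hp, Complex.norm_exp_mul_log ht, Complex.sub_re, Complex.one_re]
  have hexpn : ∀ s : ℝ, ‖Complex.exp (-(b : ℂ) * (s : ℂ))‖ = Real.exp (-(b * s)) := fun s ↦ by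
    simp [Complex.norm_exp]
  have hdom := integrableOn_exp_neg_mul_mul_rpow hcb hx1
  set g : ℝ → ℂ := fun t ↦ Complex.exp (-(b : ℂ) * (f t : ℂ)) * p t with hg
  set e : ℝ → ℂ := fun t ↦ Complex.exp (-(b : ℂ) * (t : ℂ)) * p t with he
  have hgi : IntegrableOn g (Ioo 0 1) := by
    refine Integrable.mono' (hdom.mono_set Ioo_subset_Ioi_self) ?_ ?_
    · exact AEMeasurable.aestronglyMeasurable (by fun_prop)
    · refine (ae_restrict_iff' measurableSet_Ioo).2 (ae_of_all _ fun t ht ↦ ?_)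
      rw [hg, norm_mul, hpn t ht.1, hexpn]
      have := ht.1.le
      refine mul_le_mul_of_nonneg_right (Real.exp_le_exp.2 ?_) (by positivity)
      nlinarith [hfc t ht]
  have hei : IntegrableOn e (Ioi 0) := by
    refine Integrable.mono' (integrableOn_exp_neg_mul_mul_rpow hb0 hx1) ?_ ?_
    · exact AEMeasurable.aestronglyMeasurable (by fun_prop)
    · refine (ae_restrict_iff' measurableSet_Ioi).2 (ae_of_all _ fun t ht ↦ ?_)
      rw [he, norm_mul, hpn t ht, hexpn]
  have hG : ∫ t in (0:ℝ)..1, g t = ∫ t in Ioi 0, (Ioo 0 1).indicator g t := by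
    rw [intervalIntegral.integral_of_le zero_le_one, integral_Ioc_eq_integral_Ioo,
      setIntegral_indicator measurableSet_Ioo, inter_eq_right.2 Ioo_subset_Ioi_self]
  have hE : Complex.exp (-x * (Real.log b : ℂ)) * Complex.Gamma x = ∫ t in Ioi 0, e t := by
    have h1 : (1 / (b : ℂ)) ^ x = Complex.exp (-x * (Real.log b : ℂ)) := by
      rw [one_div, ← Complex.ofReal_inv, Complex.cpow_def_of_ne_zero (by simp [hb0.ne']),
        ← Complex.ofReal_log (by positivity), Real.log_inv]
      push_cast
      ring_nf
    rw [← h1, ← Complex.integral_cpow_mul_exp_neg_mul_Ioi hx hb0]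
    refine setIntegral_congr_fun measurableSet_Ioi fun t (ht : 0 < t) ↦ ?_
    simp only [he, hp]
    rw [Complex.cpow_def_of_ne_zero (by simp [ht.ne']), ← Complex.ofReal_log ht.le]
    ring_nf
  have hsplit : ∀ t : ℝ, 0 < t → t ^ (x.re + 2 - 1) = t ^ (x.re - 1) * t ^ 2 := fun t ht ↦ by
    rw [← Real.rpow_natCast, ← Real.rpow_add ht]; norm_num; ring_nf
  rw [hG, hE, ← integral_sub
    (((integrable_indicator_iff measurableSet_Ioo).2 hgi).integrableOn) hei,
    ← Real.integral_rpow_mul_exp_neg_mul_Ioi (by linarith) hcb, ← integral_const_mul]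
  have hbound := (integrableOn_exp_neg_mul_mul_rpow hcb
    (by linarith : -1 < x.re + 2 - 1)).const_mul ((A + 1) * b)
  refine norm_integral_le_of_norm_le (by simpa only [IntegrableOn, mul_comm] using hbound) ?_
  refine (ae_restrict_iff' measurableSet_Ioi).2 (ae_of_all _ fun t (ht : 0 < t) ↦ ?_)
  rw [hsplit t ht]
  have hct : c * b * t ≤ b * t := by nlinarith [mul_pos hb0 ht]
  have hpos : 0 ≤ t ^ (x.re - 1) := by positivity
  have hexp : 0 ≤ Real.exp (-(c * b * t)) := (Real.exp_pos _).le
  by_cases h1 : t < 1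
  · have htm : t ∈ Ioo (0 : ℝ) 1 := ⟨ht, h1⟩
    have hdiff : |b * f t - b * t| ≤ (A + 1) * b * t ^ 2 := by
      rw [← mul_sub, abs_mul, abs_of_pos hb0]
      nlinarith [hfA t htm, mul_pos hb0 (pow_pos ht 2)]
    rw [indicator_of_mem htm]
    simp only [hg, he]
    rw [← sub_mul, norm_mul, hpn t ht]
    have hcast : Complex.exp (-(b : ℂ) * (f t : ℂ)) - Complex.exp (-(b : ℂ) * (t : ℂ))
        = ((Real.exp (-(b * f t)) - Real.exp (-(b * t)) : ℝ) : ℂ) := by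
      push_cast; ring_nf
    rw [hcast, Complex.norm_real, Real.norm_eq_abs]
    calc _ ≤ |b * f t - b * t| * Real.exp (-(c * b * t)) * t ^ (x.re - 1) := by
          gcongr
          exact abs_exp_neg_sub_exp_neg_le (by nlinarith [hfc t htm]) hct
      _ ≤ (A + 1) * b * t ^ 2 * Real.exp (-(c * b * t)) * t ^ (x.re - 1) := by gcongr
      _ = _ := by ring
  · rw [indicator_of_notMem (fun h ↦ h1 h.2), zero_sub, norm_neg]
    simp only [he]
    rw [norm_mul, hpn t ht, hexpn]
    have hone : 1 ≤ (A + 1) * b * t ^ 2 :=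
      one_le_mul_of_one_le_of_one_le (one_le_mul_of_one_le_of_one_le (by linarith) hb)
        (one_le_pow₀ (not_lt.1 h1))
    calc _ ≤ 1 * Real.exp (-(c * b * t)) * t ^ (x.re - 1) := by
          rw [one_mul]; gcongr
      _ ≤ (A + 1) * b * t ^ 2 * Real.exp (-(c * b * t)) * t ^ (x.re - 1) := by gcongr
      _ = _ := by ring

theorem Real.exists_Gamma_le_of_mem_Icc {a b : ℝ} (ha : 0 < a) :
    ∃ K > 0, ∀ s ∈ Icc a b, Real.Gamma s ≤ K := by
  obtain ⟨K, hK⟩ := isCompact_Icc.exists_bound_of_continuousOn (s := Icc a b) (f := Real.Gamma)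
    fun s hs ↦ (Real.differentiableAt_Gamma fun m ↦ by
      have := hs.1
      have : (0 : ℝ) ≤ m := m.cast_nonneg
      linarith).continuousAt.continuousWithinAt
  exact ⟨max K 1, by positivity, fun s hs ↦
    (le_abs_self _).trans ((hK s hs).trans (le_max_left _ _))⟩

/-- A uniform version of Watson's lemma: if `B_n → ∞`, each `φ_n` is increasing on `[0,1)`
with `|φ_n(t) - t| ≤ A t²` there, then uniformly for `ε ≤ Re x ≤ M`,
`∫_0^1 e^{-B_n φ_n(t)} t^{x-1} dt = B_n^{-x} Γ(x) + O(B_n^{-Re x - 1})`. -/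
theorem watson_lemma_uniform (ε M A : ℝ) (hε : 0 < ε) (hM : ε ≤ M) (hA : 0 < A)
    (B : ℕ → ℝ) (hB : ∀ n, 0 < B n)
    (hBtop : Filter.Tendsto B Filter.atTop Filter.atTop)
    (φ : ℕ → ℝ → ℝ)
    (hmono : ∀ n, MonotoneOn (φ n) (Set.Ico 0 1))
    (happrox : ∀ n, ∀ t ∈ Set.Ico (0 : ℝ) 1, |φ n t - t| ≤ A * t ^ 2) :
    ∃ C > 0, ∃ N : ℕ, ∀ n ≥ N, ∀ x : ℂ, ε ≤ x.re → x.re ≤ M →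
      ‖(∫ t in (0:ℝ)..1,
            Complex.exp (-(B n : ℂ) * (φ n t : ℂ)) * Complex.exp ((x - 1) * (Real.log t : ℂ)))
          - Complex.exp (-x * (Real.log (B n) : ℂ)) * Complex.Gamma x‖
        ≤ C * (B n) ^ (-x.re - 1) := by
  obtain ⟨K, hK0, hK⟩ := Real.exists_Gamma_le_of_mem_Icc (a := ε + 2) (b := M + 2) (by linarith)
  obtain ⟨N, hN⟩ := Filter.eventually_atTop.1 (hBtop.eventually_ge_atTop 1)
  set c : ℝ := 1 / (4 * (A + 1)) with hc
  have hc0 : 0 < c := by positivity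
  have hc1 : c ≤ 1 := by
    rw [hc, div_le_one (by positivity)]
    linarith
  refine ⟨(A + 1) * (c ^ (-(M + 2)) * K), by positivity, N, fun n hn x hx hxM ↦ ?_⟩
  have hmeas : AEMeasurable (φ n) (volume.restrict (Ioo 0 1)) :=
    aemeasurable_restrict_of_monotoneOn measurableSet_Ioo ((hmono n).mono Ioo_subset_Ico_self)
  refine (norm_integral_exp_mul_cpow_sub_Gamma_le hA.le (hN n hn) hc0 hc1 hmeas
    (fun t ht ↦ happrox n t (Ioo_subset_Ico_self ht))
    (fun t ht ↦ (hmono n).mul_le_of_abs_sub_le hA.le (happrox n) (Ioo_subset_Ico_self ht))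
    (hε.trans_le hx)).trans ?_
  have hBn := hB n
  have hpow : (1 / (c * B n)) ^ (x.re + 2) = c ^ (-(x.re + 2)) * B n ^ (-(x.re + 2)) := by
    rw [one_div, Real.inv_rpow (by positivity), ← Real.rpow_neg (by positivity),
      Real.mul_rpow hc0.le hBn.le]
  have hBpow : B n * B n ^ (-(x.re + 2)) = B n ^ (-x.re - 1) := by
    rw [← Real.rpow_one_add' hBn.le (by linarith)]
    ring_nf
  have hcpow : c ^ (-(x.re + 2)) ≤ c ^ (-(M + 2)) :=
    Real.rpow_le_rpow_of_exponent_ge hc0 hc1 (by linarith)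
  calc _ = (A + 1) * (c ^ (-(x.re + 2)) * Real.Gamma (x.re + 2)) * B n ^ (-x.re - 1) := by
        rw [hpow, ← hBpow]; ring
    _ ≤ _ := by
        have hΓ : Real.Gamma (x.re + 2) ≤ K := hK _ ⟨by linarith, by linarith⟩
        have hΓ0 : 0 ≤ Real.Gamma (x.re + 2) := (Real.Gamma_pos_of_pos (by linarith)).le
        gcongr
end

section
/- For all real numbers a < b, the number of complex roots z of L_d with Im z ∈ [a,b] is asymptotic to (b-a)·(log d)/π as d → ∞; that is, π·#{z ∈ ℂ : L_d(z) = 0 and a ≤ Im z ≤ b}/((b-a)·log d) → 1 as d → ∞. -/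
/-- `binom(y, d) = (∏_{k=0}^{d-1} (y - k)) / d!` for complex `y`. -/
noncomputable def cbinom (y : ℂ) (d : ℕ) : ℂ :=
  (∏ k ∈ Finset.range d, (y - k)) / (Nat.factorial d : ℂ)

/-- The Ehrhart polynomial of the `d`-dimensional cross-polytope. -/
noncomputable def Lpoly (d : ℕ) (x : ℂ) : ℂ :=
  ∑ j ∈ Finset.range (d + 1), (Nat.choose d j : ℂ) * cbinom ((d : ℂ) - (j : ℂ) + x) d

/-- The operator `(1 + E) ^ n`, where `E` is the unit shift, in expanded form. -/
noncomputable def binomShift (n : ℕ) (F : ℂ → ℂ) (x : ℂ) : ℂ :=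
  ∑ j ∈ Finset.range (n + 1), (Nat.choose n j : ℂ) * F ((n : ℂ) - (j : ℂ) + x)

theorem binomShift_zero (F : ℂ → ℂ) (x : ℂ) : binomShift 0 F x = F x := by
  simp [binomShift]

theorem binomShift_succ (n : ℕ) (F : ℂ → ℂ) (x : ℂ) :
    binomShift (n + 1) F x = binomShift n F (x + 1) + binomShift n F x := by
  have h := Finset.sum_choose_succ_mul (fun _ j : ℕ => F ((j : ℂ) + x)) n
  have h₁ : binomShift (n + 1) F x = ∑ i ∈ Finset.range (n + 2),
      ((n + 1).choose i : ℂ) * F (((n + 1 - i : ℕ) : ℂ) + x) := by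
    refine Finset.sum_congr rfl fun i hi => ?_
    rw [Nat.cast_sub (Nat.lt_succ_iff.1 (Finset.mem_range.1 hi))]
  have h₂ : binomShift n F (x + 1) = ∑ i ∈ Finset.range (n + 1),
      (n.choose i : ℂ) * F (((n + 1 - i : ℕ) : ℂ) + x) := by
    refine Finset.sum_congr rfl fun i hi => ?_
    rw [Nat.cast_sub (Finset.mem_range.1 hi).le]
    push_cast
    ring_nf
  have h₃ : binomShift n F x = ∑ i ∈ Finset.range (n + 1),
      (n.choose i : ℂ) * F (((n - i : ℕ) : ℂ) + x) := by
    refine Finset.sum_congr rfl fun i hi => ?_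
    rw [Nat.cast_sub (Nat.lt_succ_iff.1 (Finset.mem_range.1 hi))]
  rw [h₁, h₂, h₃, h]

theorem binomShift_sub (n : ℕ) (F G : ℂ → ℂ) (x : ℂ) :
    binomShift n (fun y => F y - G y) x = binomShift n F x - binomShift n G x := by
  simp [binomShift, mul_sub, Finset.sum_sub_distrib]

theorem binomShift_const_mul (n : ℕ) (c : ℂ) (F : ℂ → ℂ) (x : ℂ) :
    binomShift n (fun y => c * F y) x = c * binomShift n F x := by
  simp only [binomShift, Finset.mul_sum]
  exact Finset.sum_congr rfl fun _ _ => by ring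

theorem binomShift_comp_add_one (n : ℕ) (F : ℂ → ℂ) (x : ℂ) :
    binomShift n (fun y => F (y + 1)) x = binomShift n F (x + 1) := by
  simp only [binomShift, add_assoc]

theorem binomShift_succ_id_mul (n : ℕ) (F : ℂ → ℂ) (x : ℂ) :
    binomShift (n + 1) (fun y => y * F y) x =
      x * binomShift (n + 1) F x + (n + 1) * binomShift n F (x + 1) := by
  induction n generalizing x with
  | zero =>
    simp only [binomShift_succ, binomShift_zero]
    push_cast
    ring
  | succ n ih =>
    rw [binomShift_succ, ih, ih, binomShift_succ (n + 1) F x, binomShift_succ n F (x + 1)]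
    push_cast
    ring

theorem succ_mul_cbinom_succ (y : ℂ) (d : ℕ) :
    ((d : ℂ) + 1) * cbinom y (d + 1) = (y - d) * cbinom y d := by
  have h₁ : ((d : ℂ) + 1) ≠ 0 := Nat.cast_add_one_ne_zero d
  have h₂ : (d.factorial : ℂ) ≠ 0 := Nat.cast_ne_zero.2 d.factorial_ne_zero
  simp only [cbinom, Finset.prod_range_succ, Nat.factorial_succ]
  push_cast
  field_simp

theorem cbinom_add_one_sub (y : ℂ) (d : ℕ) :
    cbinom (y + 1) (d + 1) - cbinom y (d + 1) = cbinom y d := by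
  have h₁ : ((d : ℂ) + 1) ≠ 0 := Nat.cast_add_one_ne_zero d
  have h₂ : (d.factorial : ℂ) ≠ 0 := Nat.cast_ne_zero.2 d.factorial_ne_zero
  have h₃ : ∏ k ∈ Finset.range (d + 1), (y + 1 - k) =
      (∏ k ∈ Finset.range d, (y - k)) * (y + 1) := by
    rw [Finset.prod_range_succ']
    push_cast
    simp [add_sub_add_right_eq_sub]
  simp only [cbinom, h₃, Finset.prod_range_succ _ d, Nat.factorial_succ]
  push_cast
  field_simp
  ring

theorem Lpoly_eq_binomShift (d : ℕ) (x : ℂ) :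
    Lpoly d x = binomShift d (fun y => cbinom y d) x := rfl

theorem Lpoly_zero (x : ℂ) : Lpoly 0 x = 1 := by
  simp [Lpoly, cbinom]

theorem Lpoly_succ_add_one_sub (d : ℕ) (x : ℂ) :
    Lpoly (d + 1) (x + 1) - Lpoly (d + 1) x = Lpoly d (x + 1) + Lpoly d x := by
  simp only [Lpoly_eq_binomShift]
  rw [← binomShift_comp_add_one, ← binomShift_sub]
  simp only [cbinom_add_one_sub]
  exact binomShift_succ d _ x

theorem succ_mul_Lpoly_succ (d : ℕ) (x : ℂ) :
    ((d : ℂ) + 1) * Lpoly (d + 1) x = (x + 1) * Lpoly d (x + 1) + (x - d) * Lpoly d x := by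
  simp only [Lpoly_eq_binomShift]
  rw [← binomShift_const_mul]
  simp only [succ_mul_cbinom_succ, sub_mul]
  rw [binomShift_sub, binomShift_succ_id_mul, binomShift_const_mul, binomShift_succ]
  ring

theorem Lpoly_one (x : ℂ) : Lpoly 1 x = 2 * x + 1 := by
  have h := succ_mul_Lpoly_succ 0 x
  simp only [Lpoly_zero, Nat.cast_zero, zero_add, one_mul] at h
  rw [h]
  ring

theorem Lpoly_recurrence (d : ℕ) (x : ℂ) :
    ((d : ℂ) + 2) * Lpoly (d + 2) x =
      (2 * x + 1) * Lpoly (d + 1) x + ((d : ℂ) + 1) * Lpoly d x := by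
  have h₁ := succ_mul_Lpoly_succ (d + 1) x
  have h₂ := Lpoly_succ_add_one_sub d x
  have h₃ := succ_mul_Lpoly_succ d x
  push_cast at h₁
  linear_combination h₁ + (x + 1) * h₂ - h₃

theorem re_Lpoly_mul_conj_succ (d : ℕ) (x : ℂ) :
    ((d : ℝ) + 2) * (Lpoly (d + 2) x * starRingEnd ℂ (Lpoly (d + 1) x)).re =
      (2 * x.re + 1) * Complex.normSq (Lpoly (d + 1) x) +
        ((d : ℝ) + 1) * (Lpoly (d + 1) x * starRingEnd ℂ (Lpoly d x)).re := by
  have h := Lpoly_recurrence d x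
  have hre := congrArg Complex.re h
  have him := congrArg Complex.im h
  simp only [Complex.mul_re, Complex.mul_im, Complex.add_re, Complex.add_im, Complex.natCast_re,
    Complex.natCast_im, Complex.one_re, Complex.one_im, Complex.re_ofNat, Complex.im_ofNat,
    Complex.conj_re, Complex.conj_im, Complex.normSq_apply] at hre him ⊢
  linear_combination (Lpoly (d + 1) x).re * hre + (Lpoly (d + 1) x).im * him

theorem re_Lpoly_mul_conj_pos {x : ℂ} (hx : -1 / 2 < x.re) (d : ℕ) :
    0 < (Lpoly (d + 1) x * starRingEnd ℂ (Lpoly d x)).re := by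
  induction d with
  | zero =>
    simp only [zero_add, Lpoly_zero, Lpoly_one, map_one, mul_one]
    simp
    linarith
  | succ d ih =>
    refine pos_of_mul_pos_right (a := (d : ℝ) + 2) ?_ (by positivity)
    rw [re_Lpoly_mul_conj_succ]
    exact add_pos_of_nonneg_of_pos
      (mul_nonneg (by linarith) (Complex.normSq_nonneg _)) (mul_pos (by positivity) ih)

theorem re_Lpoly_mul_conj_neg {x : ℂ} (hx : x.re < -1 / 2) (d : ℕ) :
    (Lpoly (d + 1) x * starRingEnd ℂ (Lpoly d x)).re < 0 := by
  induction d with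
  | zero =>
    simp only [zero_add, Lpoly_zero, Lpoly_one, map_one, mul_one]
    simp
    linarith
  | succ d ih =>
    refine neg_of_mul_neg_right (a := (d : ℝ) + 2) ?_ (by positivity)
    rw [re_Lpoly_mul_conj_succ]
    exact add_neg_of_nonpos_of_neg
      (mul_nonpos_of_nonpos_of_nonneg (by linarith) (Complex.normSq_nonneg _))
      (mul_neg_of_pos_of_neg (by positivity) ih)

theorem re_eq_of_Lpoly_eq_zero {d : ℕ} {x : ℂ} (h : Lpoly d x = 0) : x.re = -1 / 2 := by
  by_contra hne
  rcases lt_or_gt_of_ne hne with hx | hx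
  · simpa [h] using re_Lpoly_mul_conj_neg hx d
  · simpa [h] using re_Lpoly_mul_conj_pos hx d

/-- The real polynomial `t ↦ (-i) ^ d L_d(-1/2 + i t)`, defined by its three-term recurrence. -/
noncomputable def criticalPoly : ℕ → ℝ → ℝ
  | 0, _ => 1
  | 1, t => 2 * t
  | n + 2, t => (2 * t * criticalPoly (n + 1) t - (n + 1) * criticalPoly n t) / (n + 2)

theorem Lpoly_critical_line (d : ℕ) (t : ℝ) :
    Lpoly d (⟨-1 / 2, t⟩ : ℂ) = Complex.I ^ d * (criticalPoly d t : ℂ) := by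
  have hs : 2 * (⟨-1 / 2, t⟩ : ℂ) + 1 = 2 * t * Complex.I := by
    apply Complex.ext <;> norm_num
  induction d using Nat.twoStepInduction with
  | zero => simp [Lpoly_zero, criticalPoly]
  | one =>
    rw [Lpoly_one, hs]
    simp [criticalPoly]
    ring
  | more n ih₀ ih₁ =>
    have h := Lpoly_recurrence n (⟨-1 / 2, t⟩ : ℂ)
    have hn : ((n : ℂ) + 2) ≠ 0 := by exact_mod_cast (show (n + 2 : ℕ) ≠ 0 by omega)
    rw [hs, ih₀, ih₁] at h
    apply mul_left_cancel₀ hn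
    rw [h]
    simp only [criticalPoly]
    push_cast
    field_simp
    ring_nf
    simp only [Complex.I_sq]
    ring

/-- The size of the perturbation of the quarter turn in one step of the recurrence. -/
noncomputable def stepSize (m : ℕ) (t θ : ℝ) : ℝ :=
  (2 * t * Real.cos θ + Real.sin θ) / (m + 2)

/-- The deviation from a quarter turn of one step of the recurrence, as a complex factor. -/
noncomputable def stepFactor (m : ℕ) (t θ : ℝ) : ℂ :=
  ⟨1 - stepSize m t θ * Real.sin θ, -(stepSize m t θ * Real.cos θ)⟩

/-- A continuous choice of the polar angle of `(criticalPoly (m + 1) t, criticalPoly m t)`. -/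
noncomputable def phase : ℕ → ℝ → ℝ
  | 0, t => Real.pi / 2 - Real.arctan (2 * t)
  | m + 1, t => phase m t + Real.pi / 2 + (stepFactor m t (phase m t)).arg

theorem stepFactor_mem_slitPlane (m : ℕ) (t θ : ℝ) : stepFactor m t θ ∈ Complex.slitPlane := by
  rw [Complex.mem_slitPlane_iff]
  by_contra! h
  obtain ⟨h₁, h₂⟩ := h
  simp only [stepFactor, neg_eq_zero, mul_eq_zero] at h₁ h₂
  rcases h₂ with h₂ | h₂
  · rw [h₂] at h₁
    linarith
  · have hs : Real.sin θ * Real.sin θ = 1 := by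
      nlinarith [Real.sin_sq_add_cos_sq θ]
    have hm : (1 : ℝ) / (m + 2) < 1 := by
      rw [div_lt_one (by positivity)]
      linarith [(Nat.cast_nonneg m : (0 : ℝ) ≤ m)]
    rw [stepSize, h₂, mul_zero, zero_add, div_mul_eq_mul_div, hs] at h₁
    linarith

theorem criticalPoly_polar (m : ℕ) (t : ℝ) : ∃ r : ℝ, 0 < r ∧
    criticalPoly (m + 1) t = r * Real.cos (phase m t) ∧
    criticalPoly m t = r * Real.sin (phase m t) := by
  induction m with
  | zero =>
    have hp : (0 : ℝ) < √(1 + (2 * t) ^ 2) := Real.sqrt_pos.2 (by positivity)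
    refine ⟨√(1 + (2 * t) ^ 2), hp, ?_, ?_⟩
    · rw [phase, Real.cos_pi_div_two_sub, Real.sin_arctan]
      simp only [criticalPoly]
      field_simp
    · rw [phase, Real.sin_pi_div_two_sub, Real.cos_arctan]
      simp only [criticalPoly]
      field_simp
  | succ m ih =>
    obtain ⟨r, hr, h₁, h₀⟩ := ih
    set θ := phase m t with hθ
    set g := stepFactor m t θ with hg
    have hg0 : 0 < ‖g‖ := norm_pos_iff.2 (Complex.slitPlane_ne_zero (stepFactor_mem_slitPlane m t θ))
    have hc : ‖g‖ * Real.cos g.arg = 1 - stepSize m t θ * Real.sin θ :=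
      Complex.norm_mul_cos_arg g
    have hs : ‖g‖ * Real.sin g.arg = -(stepSize m t θ * Real.cos θ) :=
      Complex.norm_mul_sin_arg g
    have hphase : phase (m + 1) t = θ + g.arg + Real.pi / 2 := by
      rw [phase]
      ring
    have hm : (m : ℝ) + 2 ≠ 0 := by positivity
    refine ⟨r * ‖g‖, by positivity, ?_, ?_⟩
    · rw [hphase, Real.cos_add_pi_div_two, Real.sin_add, criticalPoly, h₁, h₀]
      have hε : stepSize m t θ * (m + 2) = 2 * t * Real.cos θ + Real.sin θ := by
        rw [stepSize]
        field_simp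
      rw [div_eq_iff hm]
      linear_combination (-r) * hε + r * (m + 2) * Real.sin θ * hc +
        r * (m + 2) * Real.cos θ * hs -
        r * (m + 2) * stepSize m t θ * Real.sin_sq_add_cos_sq θ
    · rw [hphase, Real.sin_add_pi_div_two, Real.cos_add, h₁]
      linear_combination (-r * Real.cos θ) * hc + r * Real.sin θ * hs

theorem criticalPoly_succ_eq_zero_iff (m : ℕ) (t : ℝ) :
    criticalPoly (m + 1) t = 0 ↔ Real.cos (phase m t) = 0 := by
  obtain ⟨r, hr, h, -⟩ := criticalPoly_polar m t
  rw [h, mul_eq_zero, or_iff_right hr.ne']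

theorem hasDerivAt_arg_mk {f g : ℝ → ℝ} {f' g' t : ℝ} (hf : HasDerivAt f f' t)
    (hg : HasDerivAt g g' t) (h : (⟨f t, g t⟩ : ℂ) ∈ Complex.slitPlane) :
    HasDerivAt (fun u => (⟨f u, g u⟩ : ℂ).arg)
      ((f t * g' - g t * f') / (f t ^ 2 + g t ^ 2)) t := by
  have hmk : ∀ u v : ℝ, (⟨u, v⟩ : ℂ) = u + v * Complex.I := fun u v => Complex.mk_eq_add_mul_I u v
  have hfg : HasDerivAt (fun u => (⟨f u, g u⟩ : ℂ)) ⟨f', g'⟩ t := by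
    simp only [hmk]
    exact hf.ofReal_comp.add (hg.ofReal_comp.mul_const Complex.I)
  have harg := Complex.imCLM.hasFDerivAt.comp_hasDerivAt t (hfg.clog_real h)
  simp only [Function.comp_def, Complex.imCLM_apply, Complex.log_im] at harg
  refine harg.congr_deriv ?_
  rw [Complex.div_im, Complex.normSq_apply]
  ring

theorem exists_hasDerivAt_phase_neg (m : ℕ) (t : ℝ) :
    ∃ v : ℝ, v < 0 ∧ HasDerivAt (phase m) v t := by
  induction m with
  | zero =>
    have h := (((hasDerivAt_id t).const_mul 2).arctan).const_sub (Real.pi / 2)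
    refine ⟨_, ?_, h⟩
    have : (0 : ℝ) < 1 / (1 + (2 * id t) ^ 2) * (2 * 1) := by positivity
    linarith
  | succ m ih =>
    obtain ⟨v, hv, h⟩ := ih
    have hm : (0 : ℝ) < m + 2 := by positivity
    have hε : HasDerivAt (fun u => stepSize m u (phase m u))
        ((2 * Real.cos (phase m t) + v * (-2 * t * Real.sin (phase m t) + Real.cos (phase m t)))
          / (m + 2)) t := by
      refine (((((hasDerivAt_id t).const_mul 2).mul h.cos).add h.sin).div_const
        ((m : ℝ) + 2)).congr_deriv ?_
      simp only [id]
      ring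
    have hre := (hε.mul h.sin).const_sub 1
    have him := (hε.mul h.cos).neg
    have harg := hasDerivAt_arg_mk hre him (stepFactor_mem_slitPlane m t (phase m t))
    refine ⟨_, ?_, (h.add_const (Real.pi / 2)).add harg⟩
    simp only [Pi.mul_apply, Pi.neg_apply]
    have hpos : 0 < Complex.normSq (stepFactor m t (phase m t)) :=
      Complex.normSq_pos.2 (Complex.slitPlane_ne_zero (stepFactor_mem_slitPlane m t (phase m t)))
    rw [Complex.normSq_apply] at hpos
    simp only [stepFactor] at hpos
    have hsize : stepSize m t (phase m t) * (m + 2) =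
        2 * t * Real.cos (phase m t) + Real.sin (phase m t) := by
      rw [stepSize]
      field_simp
    have hsc := Real.sin_sq_add_cos_sq (phase m t)
    set e := stepSize m t (phase m t)
    set c := Real.cos (phase m t)
    set s := Real.sin (phase m t)
    rw [← sq, ← sq] at hpos
    have hval : (v * (m + 1) - 2 * c ^ 2) / (m + 2) / ((1 - e * s) ^ 2 + (-(e * c)) ^ 2) < 0 := by
      refine div_neg_of_neg_of_pos (div_neg_of_neg_of_pos ?_ hm) hpos
      nlinarith [mul_neg_of_neg_of_pos hv (show (0 : ℝ) < m + 1 by positivity), sq_nonneg c]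
    refine lt_of_eq_of_lt ?_ hval
    rw [eq_div_iff hpos.ne', add_mul, div_mul_cancel₀ _ hpos.ne', eq_div_iff hm.ne']
    set d := (2 * c + v * (-2 * t * s + c)) / ((m : ℝ) + 2) with hd_def
    have hd : d * (m + 2) = 2 * c + v * (-2 * t * s + c) := by
      rw [hd_def]
      field_simp
    linear_combination (-(v * s)) * hsize - c * hd - v * hsc

theorem strictAnti_phase (m : ℕ) : StrictAnti (phase m) := by
  refine strictAnti_of_deriv_neg fun t => ?_
  obtain ⟨v, hv, h⟩ := exists_hasDerivAt_phase_neg m t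
  rwa [h.deriv]

theorem continuous_phase (m : ℕ) : Continuous (phase m) :=
  continuous_iff_continuousAt.2 fun t =>
    let ⟨_, _, h⟩ := exists_hasDerivAt_phase_neg m t
    h.continuousAt

theorem abs_arg_one_add_sub_im_le (z : ℂ) : |(1 + z).arg - z.im| ≤ 15 * ‖z‖ ^ 2 := by
  rcases le_or_gt ‖z‖ (1 / 2) with hz | hz
  · have h := Complex.norm_log_one_add_sub_self_le (z := z) (by linarith)
    have h₁ : |(1 + z).arg - z.im| ≤ ‖Complex.log (1 + z) - z‖ := by
      simpa [Complex.log_im] using Complex.abs_im_le_norm (Complex.log (1 + z) - z)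
    have h₂ : (1 - ‖z‖)⁻¹ ≤ 2 := by
      rw [inv_le_comm₀ (by linarith) (by norm_num)]
      linarith
    nlinarith [mul_le_mul_of_nonneg_left h₂ (sq_nonneg ‖z‖), sq_nonneg ‖z‖]
  · have h := abs_sub (1 + z).arg z.im
    have h₁ := Complex.abs_arg_le_pi (1 + z)
    have h₂ := Complex.abs_im_le_norm z
    nlinarith [Real.pi_lt_d2]

/-- The oscillating part of the first-order angular increment. -/
noncomputable def phaseOsc (t θ : ℝ) : ℝ :=
  t * Real.cos (2 * θ) + Real.sin (2 * θ) / 2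

theorem abs_phaseOsc_le (t θ : ℝ) : |phaseOsc t θ| ≤ |t| + 1 := by
  have h₁ : |t * Real.cos (2 * θ)| ≤ |t| := by
    rw [abs_mul]
    exact mul_le_of_le_one_right (abs_nonneg t) (Real.abs_cos_le_one _)
  have h₂ := Real.abs_sin_le_one (2 * θ)
  rw [phaseOsc]
  rw [abs_le] at *
  constructor <;> linarith

theorem phaseOsc_add_pi_div_two (t θ : ℝ) :
    phaseOsc t (θ + Real.pi / 2) = -phaseOsc t θ := by
  simp only [phaseOsc, mul_add, mul_div_cancel₀ Real.pi (two_ne_zero' ℝ), Real.cos_add_pi,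
    Real.sin_add_pi]
  ring

theorem abs_phaseOsc_sub_le (t θ φ : ℝ) :
    |phaseOsc t θ - phaseOsc t φ| ≤ (2 * |t| + 1) * |θ - φ| := by
  have h₁ := Real.abs_cos_sub_cos_le (2 * θ) (2 * φ)
  have h₂ := Real.abs_sin_sub_sin_le (2 * θ) (2 * φ)
  have h₃ : |2 * θ - 2 * φ| = 2 * |θ - φ| := by
    rw [← mul_sub, abs_mul, abs_two]
  rw [h₃] at h₁ h₂
  calc |phaseOsc t θ - phaseOsc t φ|
      = |t * (Real.cos (2 * θ) - Real.cos (2 * φ)) +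
          (Real.sin (2 * θ) - Real.sin (2 * φ)) / 2| := by
        simp only [phaseOsc]
        ring_nf
    _ ≤ |t| * |Real.cos (2 * θ) - Real.cos (2 * φ)| +
          |Real.sin (2 * θ) - Real.sin (2 * φ)| / 2 := by
        refine (abs_add_le _ _).trans_eq ?_
        rw [abs_mul, abs_div, abs_two]
    _ ≤ (2 * |t| + 1) * |θ - φ| := by
        nlinarith [mul_le_mul_of_nonneg_left h₁ (abs_nonneg t)]

theorem abs_stepSize_le (m : ℕ) (t θ : ℝ) : |stepSize m t θ| ≤ (2 * |t| + 1) / (m + 2) := by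
  rw [stepSize, abs_div, abs_of_pos (show (0 : ℝ) < m + 2 by positivity)]
  gcongr
  refine (abs_add_le _ _).trans (add_le_add ?_ (Real.abs_sin_le_one θ))
  rw [abs_mul, abs_mul, abs_two]
  exact mul_le_of_le_one_right (by positivity) (Real.abs_cos_le_one θ)

theorem stepSize_mul_cos (m : ℕ) (t θ : ℝ) :
    stepSize m t θ * Real.cos θ = (t + phaseOsc t θ) / (m + 2) := by
  rw [stepSize, phaseOsc, Real.cos_two_mul, Real.sin_two_mul]
  ring

theorem abs_arg_stepFactor_add_le (m : ℕ) (t θ : ℝ) :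
    |(stepFactor m t θ).arg + (t + phaseOsc t θ) / (m + 2)| ≤
      15 * ((2 * |t| + 1) / (m + 2)) ^ 2 := by
  set z : ℂ := ⟨-(stepSize m t θ * Real.sin θ), -(stepSize m t θ * Real.cos θ)⟩ with hz
  have h₁ : stepFactor m t θ = 1 + z := by
    apply Complex.ext <;> simp [stepFactor, hz, sub_eq_add_neg]
  have h₂ : ‖z‖ ^ 2 = |stepSize m t θ| ^ 2 := by
    rw [← Complex.normSq_eq_norm_sq, Complex.normSq_apply, sq_abs, hz]
    linear_combination stepSize m t θ ^ 2 * Real.sin_sq_add_cos_sq θ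
  have h₃ : (t + phaseOsc t θ) / (m + 2) = -z.im := by
    rw [← stepSize_mul_cos, hz, neg_neg]
  rw [h₁, h₃, ← sub_eq_add_neg]
  refine (abs_arg_one_add_sub_im_le z).trans ?_
  rw [h₂]
  gcongr
  exact abs_stepSize_le m t θ

/-- The phase with its linear, logarithmic and oscillating parts removed. -/
noncomputable def phaseRemainder (t : ℝ) (m : ℕ) : ℝ :=
  phase m t - m * (Real.pi / 2) + t * harmonic (m + 1) -
    phaseOsc t (phase m t) / (2 * (m + 1))

theorem exists_abs_phaseRemainder_succ_sub_le (t : ℝ) : ∃ C : ℝ, 0 ≤ C ∧ ∀ m : ℕ,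
    |phaseRemainder t (m + 1) - phaseRemainder t m| ≤ C * (1 / (m + 1) - 1 / (m + 2)) := by
  set B := 2 * |t| + 1 with hB
  have hB1 : 1 ≤ B := by linarith [abs_nonneg t]
  refine ⟨15 * B ^ 2 + B + 16 * B ^ 3, by positivity, fun m => ?_⟩
  set θ := phase m t with hθ
  set δ := (stepFactor m t θ).arg with hδ
  set N : ℝ := (m : ℝ) + 2 with hN
  have hN2 : 2 ≤ N := by linarith [(Nat.cast_nonneg m : (0 : ℝ) ≤ m)]
  have h₁ : |δ + (t + phaseOsc t θ) / N| ≤ 15 * (B / N) ^ 2 := abs_arg_stepFactor_add_le m t θ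
  have hosc := abs_phaseOsc_le t θ
  have h₂ : |δ| ≤ 16 * B ^ 2 / N := by
    have h := abs_sub (δ + (t + phaseOsc t θ) / N) ((t + phaseOsc t θ) / N)
    rw [add_sub_cancel_right] at h
    have h₄ : |(t + phaseOsc t θ) / N| ≤ B / N := by
      rw [abs_div, abs_of_pos (show 0 < N by linarith)]
      gcongr
      linarith [abs_add_le t (phaseOsc t θ)]
    have h₅ : (B / N) ^ 2 ≤ B ^ 2 / N := by
      rw [div_pow]
      gcongr
      nlinarith
    have h₆ : B / N ≤ B ^ 2 / N := by
      gcongr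
      nlinarith
    rw [mul_div_assoc]
    linarith
  have hphase : phase (m + 1) t = θ + δ + Real.pi / 2 := by
    rw [phase]
    ring
  set η := phaseOsc t (θ + δ) - phaseOsc t θ with hη
  have h₃ : |η| ≤ B * |δ| := by
    simpa using abs_phaseOsc_sub_le t (θ + δ) θ
  have hm : (m : ℝ) + 1 = N - 1 := by
    rw [hN]
    ring
  have hdiff : phaseRemainder t (m + 1) - phaseRemainder t m =
      (δ + (t + phaseOsc t θ) / N) + phaseOsc t θ * (1 / (N - 1) - 1 / N) / 2
        + η / (2 * N) := by
    rw [phaseRemainder, phaseRemainder, hphase, phaseOsc_add_pi_div_two, harmonic_succ (m + 1)]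
    push_cast
    rw [show (m : ℝ) + 1 + 1 = N by rw [hN]; ring, hm, ← hθ,
      show phaseOsc t (θ + δ) = phaseOsc t θ + η by rw [hη]; ring]
    field_simp
    ring
  rw [hdiff, hm]
  have hN1 : 0 < N - 1 := by linarith
  have hN0 : 0 < N := by linarith
  have hq : 1 / N ^ 2 ≤ 1 / (N - 1) - 1 / N := by
    rw [div_sub_div _ _ hN1.ne' hN0.ne', div_le_div_iff₀ (by positivity) (by positivity)]
    nlinarith
  set q := 1 / (N - 1) - 1 / N
  have hq0 : 0 ≤ q := le_trans (by positivity) hq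
  have e₁ : 15 * (B / N) ^ 2 ≤ 15 * B ^ 2 * q := by
    rw [div_pow, mul_assoc, div_eq_mul_one_div (B ^ 2)]
    gcongr
  have e₂ : |phaseOsc t θ * q / 2| ≤ B * q := by
    rw [abs_div, abs_mul, abs_of_nonneg hq0, abs_two]
    nlinarith [abs_nonneg t]
  have e₃ : |η / (2 * N)| ≤ 16 * B ^ 3 * q := by
    rw [abs_div, abs_of_pos (show 0 < 2 * N by linarith)]
    calc |η| / (2 * N) ≤ (B * (16 * B ^ 2 / N)) / (1 * N) := by
          gcongr
          · exact h₃.trans (by gcongr)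
          · norm_num
      _ = 16 * B ^ 3 * (1 / N ^ 2) := by
          field_simp
      _ ≤ 16 * B ^ 3 * q := by gcongr
  have e₄ := abs_add_three (δ + (t + phaseOsc t θ) / N) (phaseOsc t θ * q / 2) (η / (2 * N))
  linarith

theorem exists_abs_phase_add_le (t : ℝ) : ∃ C : ℝ, ∀ m : ℕ,
    |phase m t - m * (Real.pi / 2) + t * harmonic (m + 1)| ≤ C := by
  obtain ⟨C, hC, h⟩ := exists_abs_phaseRemainder_succ_sub_le t
  have hbd : ∀ m : ℕ, |phaseRemainder t m| ≤ |phaseRemainder t 0| + C * (1 - 1 / (m + 1)) := by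
    intro m
    induction m with
    | zero => simp
    | succ m ih =>
      have h₁ := abs_sub_abs_le_abs_sub (phaseRemainder t (m + 1)) (phaseRemainder t m)
      have h₂ := h m
      push_cast
      rw [show (m : ℝ) + 1 + 1 = m + 2 by ring]
      linarith
  refine ⟨|phaseRemainder t 0| + C + (|t| + 1), fun m => ?_⟩
  have h₁ : |phaseOsc t (phase m t) / (2 * (m + 1))| ≤ |t| + 1 := by
    rw [abs_div]
    refine (div_le_self (abs_nonneg _) ?_).trans (abs_phaseOsc_le _ _)
    rw [abs_of_pos (by positivity)]
    linarith [(Nat.cast_nonneg m : (0 : ℝ) ≤ m)]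
  have h₂ : |phaseRemainder t m| ≤ |phaseRemainder t 0| + C := by
    refine (hbd m).trans ?_
    have : 0 ≤ C * (1 / ((m : ℝ) + 1)) := by positivity
    linarith
  have h₃ : phase m t - m * (Real.pi / 2) + t * harmonic (m + 1) =
      phaseRemainder t m + phaseOsc t (phase m t) / (2 * (m + 1)) := by
    rw [phaseRemainder]
    ring
  rw [h₃]
  exact (abs_add_le _ _).trans (add_le_add h₂ h₁)

theorem abs_ncard_cos_eq_zero_sub_le {f : ℝ → ℝ} (hf : Continuous f) (hanti : StrictAnti f)
    {a b : ℝ} (hab : a < b) :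
    |Real.pi * ({t : ℝ | Real.cos (f t) = 0 ∧ a ≤ t ∧ t ≤ b}.ncard : ℝ) - (f a - f b)| ≤
      Real.pi := by
  have hpi := Real.pi_pos
  set u := f b / Real.pi - 1 / 2 with hu
  set v := f a / Real.pi - 1 / 2 with hv
  have huv : u < v := by
    have := hanti hab
    rw [hu, hv]
    gcongr
  have himage : f '' {t : ℝ | Real.cos (f t) = 0 ∧ a ≤ t ∧ t ≤ b} =
      (fun k : ℤ => (2 * (k : ℝ) + 1) * Real.pi / 2) '' (Finset.Icc ⌈u⌉ ⌊v⌋ : Finset ℤ) := by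
    have hmem : ∀ k : ℤ, k ∈ Finset.Icc ⌈u⌉ ⌊v⌋ ↔
        f b ≤ (2 * (k : ℝ) + 1) * Real.pi / 2 ∧ (2 * (k : ℝ) + 1) * Real.pi / 2 ≤ f a := by
      intro k
      rw [Finset.mem_Icc, Int.ceil_le, Int.le_floor, hu, hv, sub_le_iff_le_add, le_sub_iff_add_le,
        div_le_iff₀ hpi, le_div_iff₀ hpi]
      constructor <;> rintro ⟨h₁, h₂⟩ <;> constructor <;> linarith
    ext y
    constructor
    · rintro ⟨t, ⟨ht, hat, htb⟩, rfl⟩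
      obtain ⟨k, hk⟩ := Real.cos_eq_zero_iff.1 ht
      refine ⟨k, ?_, hk.symm⟩
      rw [Finset.mem_coe, hmem, ← hk]
      exact ⟨hanti.antitone htb, hanti.antitone hat⟩
    · rintro ⟨k, hk, rfl⟩
      rw [Finset.mem_coe, hmem] at hk
      obtain ⟨t, ht, hft⟩ := intermediate_value_Icc' hab.le hf.continuousOn hk
      exact ⟨t, ⟨Real.cos_eq_zero_iff.2 ⟨k, hft⟩, ht⟩, hft⟩
  have hinj : Function.Injective (fun k : ℤ => (2 * (k : ℝ) + 1) * Real.pi / 2) := by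
    intro k l hkl
    have h : (2 * (k : ℝ) + 1) * Real.pi = (2 * (l : ℝ) + 1) * Real.pi := by
      simp only at hkl
      linarith
    have h' := mul_right_cancel₀ hpi.ne' h
    exact_mod_cast (show (k : ℝ) = l by linarith)
  have hcard : ({t : ℝ | Real.cos (f t) = 0 ∧ a ≤ t ∧ t ≤ b}.ncard : ℤ) = ⌊v⌋ + 1 - ⌈u⌉ := by
    rw [← Set.ncard_image_of_injective _ hanti.injective, himage,
      Set.ncard_image_of_injective _ hinj, Set.ncard_coe_finset, Int.card_Icc]
    refine Int.toNat_of_nonneg ?_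
    have h₁ := Int.lt_floor_add_one v
    have h₂ := Int.ceil_lt_add_one u
    have : (⌈u⌉ : ℝ) < ((⌊v⌋ + 2 : ℤ) : ℝ) := by
      push_cast
      linarith
    have := Int.cast_lt.1 this
    omega
  have hcard' : ({t : ℝ | Real.cos (f t) = 0 ∧ a ≤ t ∧ t ≤ b}.ncard : ℝ) = ⌊v⌋ + 1 - ⌈u⌉ := by
    exact_mod_cast hcard
  have hfab : f a - f b = Real.pi * (v - u) := by
    rw [hu, hv]
    field_simp
    ring
  rw [hcard', hfab, ← mul_sub, abs_mul, abs_of_pos hpi]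
  refine mul_le_of_le_one_right hpi.le (abs_le.2 ⟨?_, ?_⟩)
  · linarith [Int.lt_floor_add_one v, Int.ceil_lt_add_one u]
  · linarith [Int.floor_le v, Int.le_ceil u]

theorem ncard_Lpoly_roots_eq (m : ℕ) (a b : ℝ) :
    {z : ℂ | Lpoly (m + 1) z = 0 ∧ a ≤ z.im ∧ z.im ≤ b}.ncard =
      {t : ℝ | Real.cos (phase m t) = 0 ∧ a ≤ t ∧ t ≤ b}.ncard := by
  have hinj : Function.Injective (fun t : ℝ => (⟨-1 / 2, t⟩ : ℂ)) :=
    fun s t h => congrArg Complex.im h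
  have hzero : ∀ t : ℝ, Lpoly (m + 1) ⟨-1 / 2, t⟩ = 0 ↔ Real.cos (phase m t) = 0 := by
    intro t
    rw [Lpoly_critical_line, mul_eq_zero, or_iff_right (pow_ne_zero _ Complex.I_ne_zero),
      Complex.ofReal_eq_zero, criticalPoly_succ_eq_zero_iff]
  rw [← Set.ncard_image_of_injective _ hinj]
  congr 1
  ext z
  constructor
  · rintro ⟨hz, h⟩
    have hz' : (⟨-1 / 2, z.im⟩ : ℂ) = z := Complex.ext (re_eq_of_Lpoly_eq_zero hz).symm rfl
    exact ⟨z.im, ⟨(hzero _).1 (hz'.symm ▸ hz), h⟩, hz'⟩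
  · rintro ⟨t, ⟨ht, h⟩, rfl⟩
    exact ⟨(hzero t).2 ht, h⟩

theorem exists_abs_ncard_Lpoly_roots_sub_harmonic_le {a b : ℝ} (hab : a < b) :
    ∃ C : ℝ, ∀ m : ℕ,
      |Real.pi * ({z : ℂ | Lpoly (m + 1) z = 0 ∧ a ≤ z.im ∧ z.im ≤ b}.ncard : ℝ) -
        (b - a) * harmonic (m + 1)| ≤ C := by
  obtain ⟨A, hA⟩ := exists_abs_phase_add_le a
  obtain ⟨B, hB⟩ := exists_abs_phase_add_le b
  refine ⟨Real.pi + A + B, fun m => ?_⟩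
  have h₁ := abs_ncard_cos_eq_zero_sub_le (continuous_phase m) (strictAnti_phase m) hab
  have h₂ := hA m
  have h₃ := hB m
  rw [ncard_Lpoly_roots_eq]
  rw [abs_le] at *
  constructor <;> linarith

theorem tendsto_harmonic_div_log :
    Filter.Tendsto (fun n : ℕ => (harmonic n : ℝ) / Real.log n) Filter.atTop (nhds 1) := by
  have hlog : Filter.Tendsto (fun n : ℕ => Real.log n) Filter.atTop Filter.atTop :=
    Real.tendsto_log_atTop.comp tendsto_natCast_atTop_atTop
  have h := (Real.tendsto_harmonic_sub_log.div_atTop hlog).add_const 1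
  rw [zero_add] at h
  refine h.congr' ?_
  filter_upwards [hlog.eventually_gt_atTop 0] with n hn
  field_simp
  ring

/-- The number of roots of `L_d` with imaginary part in `[a,b]` is asymptotic to
`(b-a) (log d)/π` as `d → ∞`. -/
theorem ehrhart_root_count_asymptotic (a b : ℝ) (hab : a < b) :
    Filter.Tendsto
      (fun d : ℕ =>
        Real.pi * ({z : ℂ | Lpoly d z = 0 ∧ a ≤ z.im ∧ z.im ≤ b}.ncard : ℝ) /
          ((b - a) * Real.log d))
      Filter.atTop (nhds 1) := by
  obtain ⟨C, hC⟩ := exists_abs_ncard_Lpoly_roots_sub_harmonic_le hab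
  have hba : 0 < b - a := sub_pos.2 hab
  have hlog : Filter.Tendsto (fun n : ℕ => (b - a) * Real.log n) Filter.atTop Filter.atTop :=
    (Real.tendsto_log_atTop.comp tendsto_natCast_atTop_atTop).const_mul_atTop hba
  have herr : Filter.Tendsto (fun d : ℕ =>
      (Real.pi * ({z : ℂ | Lpoly d z = 0 ∧ a ≤ z.im ∧ z.im ≤ b}.ncard : ℝ) -
        (b - a) * harmonic d) / ((b - a) * Real.log d)) Filter.atTop (nhds 0) := by
    refine squeeze_zero_norm' ?_ (tendsto_const_nhds (x := C).div_atTop hlog)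
    filter_upwards [hlog.eventually_gt_atTop 0, Filter.eventually_ge_atTop 1] with d hd hd1
    obtain ⟨m, rfl⟩ := Nat.exists_eq_add_of_le' hd1
    rw [Real.norm_eq_abs, abs_div, abs_of_pos hd]
    gcongr
    exact hC m
  have h := herr.add tendsto_harmonic_div_log
  rw [zero_add] at h
  refine h.congr fun d => ?_
  rw [sub_div, mul_div_mul_left _ _ hba.ne', sub_add_cancel]
end
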